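/- Let V be a finite-dimensional vector space over F₂ with a nondegenerate symmetric bilinear form b. Then the set 𝒬_b of quadratic forms associated to b is nonempty, and the action of V on 𝒬_b given by (α + q)(x) := q(x) + 2b(α, x) is free and transitive; that is, 𝒬_b is an affine space over V. -/

import Mathlib

/-- The embedding `F₂ ≅ 2ℤ/4ℤ ⊂ ℤ/4ℤ`. -/
def emb2 (t : ZMod 2) : ZMod 4 := 2 * t.val

/-- The set of quadratic forms (with values in `ℤ/4ℤ`) associated to a symmetric
`F₂`-bilinear form `β`. -/
def QuadSet {V : Type*} [Add V] (β : V → V → ZMod 2) : Set (V → ZMod 4) :=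
  {q | ∀ x y, q (x + y) = q x + q y + emb2 (β x y)}

theorem emb2_add (s t : ZMod 2) : emb2 (s + t) = emb2 s + emb2 t := by
  revert s t; decide

theorem emb2_inj (s t : ZMod 2) (h : emb2 s = emb2 t) : s = t := by
  revert s t; decide

theorem emb2_sum {ι : Type*} (s : Finset ι) (f : ι → ZMod 2) :
    emb2 (∑ i ∈ s, f i) = ∑ i ∈ s, emb2 (f i) :=
  map_sum (AddMonoidHom.mk' emb2 emb2_add) f s

def lft (t : ZMod 2) : ZMod 4 := t.val

theorem lft_add (s t : ZMod 2) : lft (s + t) = lft s + lft t + 2 * (lft s * lft t) := by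
  revert s t; decide

theorem emb2_mul3 (r s t : ZMod 2) : emb2 (r * (s * t)) = 2 * (lft t * lft r * lft s) := by
  revert r s t; decide

theorem T_symm {ι : Type*} [Fintype ι] (B : ι → ι → ZMod 4) (hB : ∀ i j, B i j = B j i)
    (u v : ι → ZMod 4) : ∑ i, ∑ j, B i j * u i * v j = ∑ i, ∑ j, B i j * v i * u j := by
  rw [Finset.sum_comm]
  refine Finset.sum_congr rfl fun i _ => Finset.sum_congr rfl fun j _ => ?_
  rw [hB]; ring

theorem f_add {ι : Type*} [Fintype ι] (B : ι → ι → ZMod 4) (hB : ∀ i j, B i j = B j i)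
    (u v c : ι → ZMod 4) :
    ∑ i, ∑ j, B i j * (u i + v i + 2 * c i) * (u j + v j + 2 * c j) =
    ∑ i, ∑ j, B i j * u i * u j + ∑ i, ∑ j, B i j * v i * v j
      + ∑ i, ∑ j, 2 * (B i j * u i * v j) := by
  have h4 : (4 : ZMod 4) = 0 := by decide
  have e : ∀ i j, B i j * (u i + v i + 2 * c i) * (u j + v j + 2 * c j) =
      B i j * u i * u j + B i j * v i * v j + B i j * u i * v j + B i j * v i * u j
      + 2 * (B i j * c i * (u j + v j)) + 2 * (B i j * (u i + v i) * c j) := by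
    intro i j
    linear_combination (B i j * c i * c j) * h4
  simp only [e, Finset.sum_add_distrib, ← Finset.mul_sum]
  rw [T_symm B hB v u, T_symm B hB c (fun j => u j + v j)]
  linear_combination (∑ i, ∑ j, B i j * (u i + v i) * c j) * h4

/-- Let `V` be a finite-dimensional vector space over `F₂` with a
nondegenerate symmetric bilinear form `b`.  Then the set `𝒬_b` of quadratic forms associated
to `b` is nonempty, and the action of `V` on `𝒬_b` given by `(α + q)(x) := q(x) + 2b(α, x)` is
free and transitive; that is, `𝒬_b` is an affine space over `V`. -/
theorem statement16 (V : Type) [AddCommGroup V] [Module (ZMod 2) V]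
    [FiniteDimensional (ZMod 2) V]
    (b : V →ₗ[ZMod 2] V →ₗ[ZMod 2] ZMod 2)
    (hsymm : ∀ x y : V, b x y = b y x)
    (hnd : ∀ x : V, (∀ y : V, b x y = 0) → x = 0) :
    (QuadSet (fun x y => b x y)).Nonempty ∧
    (∀ q ∈ QuadSet (fun x y => b x y), ∀ α : V,
      (fun x => q x + emb2 (b α x)) ∈ QuadSet (fun x y => b x y)) ∧
    (∀ q ∈ QuadSet (fun x y => b x y), ∀ q' ∈ QuadSet (fun x y => b x y),
      ∃! α : V, ∀ x : V, q' x = q x + emb2 (b α x)) := by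
  classical
  refine ⟨?_, ?_, ?_⟩
  · let e := Module.finBasis (ZMod 2) V
    refine ⟨fun x => ∑ i, ∑ j, lft (b (e i) (e j)) * lft (e.repr x i) * lft (e.repr x j), ?_⟩
    intro x y
    have hb : b x y = ∑ i, ∑ j, e.repr x i * (e.repr y j * b (e i) (e j)) := by
      conv_lhs => rw [← e.sum_repr x, ← e.sum_repr y]
      simp only [map_sum, map_smul, LinearMap.sum_apply, LinearMap.smul_apply, smul_eq_mul, Finset.mul_sum]
      rw [Finset.sum_comm]
      exact Finset.sum_congr rfl fun i _ => Finset.sum_congr rfl fun j _ => by ring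
    simp only [hb, emb2_sum, emb2_mul3, map_add, Finsupp.add_apply, lft_add]
    exact f_add (fun i j => lft (b (e i) (e j))) (fun i j => by rw [hsymm])
      (fun i => lft (e.repr x i)) (fun i => lft (e.repr y i)) _
  · intro q hq α x y
    have := hq x y
    simp only [map_add, emb2_add] at this ⊢
    rw [this]; ring
  · intro q hq q' hq'
    have hd : ∀ x y, q' (x + y) - q (x + y) = (q' x - q x) + (q' y - q y) := by
      intro x y
      rw [hq x y, hq' x y]; ring
    have h0 : q' 0 - q 0 = 0 := by simpa using hd 0 0
    have h2 : ∀ x, (q' x - q x) + (q' x - q x) = 0 := by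
      intro x
      rw [← hd, ← two_smul (ZMod 2) x, show (2 : ZMod 2) = 0 from rfl, zero_smul, h0]
    have key : ∀ a c : ZMod 4, a + a = 0 → c + c = 0 →
      (if a + c = 0 then (0 : ZMod 2) else 1)
        = (if a = 0 then 0 else 1) + (if c = 0 then 0 else 1) := by decide
    have key2 : ∀ a : ZMod 4, a + a = 0 → emb2 (if a = 0 then (0 : ZMod 2) else 1) = a := by
      decide
    let φ : V →+ ZMod 2 := AddMonoidHom.mk' (fun x => if q' x - q x = 0 then 0 else 1) (by
      intro x y
      simp only [hd]
      exact key _ _ (h2 x) (h2 y))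
    have hinj : Function.Injective b := by
      rw [injective_iff_map_eq_zero]
      intro x hx
      exact hnd x fun y => by rw [hx]; rfl
    have hsurj : Function.Surjective b :=
      (LinearMap.injective_iff_surjective_of_finrank_eq_finrank
        (Subspace.dual_finrank_eq (K := ZMod 2) (V := V)).symm).1 hinj
    obtain ⟨α, hα⟩ := hsurj (φ.toZModLinearMap 2)
    have hαx : ∀ x, q' x = q x + emb2 (b α x) := by
      intro x
      have : emb2 (b α x) = q' x - q x := by
        rw [hα]; exact key2 _ (h2 x)
      rw [this]; ring
    refine ⟨α, hαx, fun γ hγ => hinj (LinearMap.ext fun x => emb2_inj _ _ ?_)⟩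
    exact add_left_cancel ((hγ x).symm.trans (hαx x))
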